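/- Let α be an irrational real number and d be any real number. Then the topological closure of the set {frac(nα + 2^n·d) : n ≥ 1} ⊆ [0,1] has Hausdorff dimension equal to 1, where frac(x) denotes the fractional part of x. -/

import Mathlib

open MeasureTheory

lemma exists_half_pow_near {δ ε s : ℝ} (hδ : 0 ≤ δ) (hδ' : δ ≤ 1 / 2) (hε : 0 < ε)
    (hs : 0 < s) (hs' : s ≤ 1) :
    ∃ m : ℕ, δ < (1 / 2) ^ m ∧ ((1 / 2 : ℝ) ^ m) ^ s ≤ 4 * δ ^ s + ε := by
  rcases hδ.eq_or_lt with rfl | hpos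
  · have h : Filter.Tendsto (fun m : ℕ => ((1 / 2 : ℝ) ^ m) ^ s) Filter.atTop (nhds (0 ^ s)) :=
      (tendsto_pow_atTop_nhds_zero_of_lt_one (by norm_num) (by norm_num)).rpow_const
        (Or.inr hs.le)
    rw [Real.zero_rpow hs.ne'] at h
    obtain ⟨m, hm⟩ := (h.eventually_lt_const hε).exists
    refine ⟨m, by positivity, ?_⟩
    rw [Real.zero_rpow hs.ne']
    linarith
  · obtain ⟨m, h1, h2⟩ := exists_nat_pow_near_of_lt_one (x := 2 * δ) (y := 1 / 2)
      (by linarith) (by linarith) (by norm_num) (by norm_num)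
    refine ⟨m, by linarith, ?_⟩
    have h3 : ((1 / 2 : ℝ) ^ m) ^ s ≤ (4 * δ) ^ s := by
      apply Real.rpow_le_rpow (by positivity) _ hs.le
      rw [pow_succ] at h1
      linarith
    have h4 : (4 : ℝ) ^ s ≤ 4 := by
      simpa using Real.rpow_le_rpow_of_exponent_le (x := 4) (by norm_num) hs'
    rw [Real.mul_rpow (by norm_num) hδ] at h3
    nlinarith [Real.rpow_nonneg hδ s]

lemma exists_finite_dyadic_cover {A : Set ℝ} (hA : IsCompact A) {s : ℝ} (hs : 0 < s)
    (hs' : s ≤ 1) (h : μH[s] A = 0) {η : ℝ} (hη : 0 < η) :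
    ∃ (F : Finset ℕ) (a : ℕ → ℝ) (m : ℕ → ℕ),
      (∀ x ∈ A, ∃ i ∈ F, |x - a i| < (1 / 2) ^ m i) ∧
        ∑ i ∈ F, ((1 / 2 : ℝ) ^ m i) ^ s < η := by
  rw [Measure.hausdorffMeasure_apply] at h
  have h0 : (⨅ (t : ℕ → Set ℝ) (_ : A ⊆ ⋃ n, t n)
      (_ : ∀ n, Metric.ediam (t n) ≤ ENNReal.ofReal (1 / 2)),
      ∑' n, ⨆ _ : (t n).Nonempty, Metric.ediam (t n) ^ s) < ENNReal.ofReal (η / 8) := by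
    refine lt_of_le_of_lt ?_ (ENNReal.ofReal_pos.2 (by positivity : 0 < η / 8))
    rw [← h]
    exact le_iSup₂_of_le (ENNReal.ofReal (1 / 2)) (ENNReal.ofReal_pos.2 (by norm_num)) le_rfl
  simp only [iInf_lt_iff] at h0
  obtain ⟨t, htA, htd, hsum⟩ := h0
  have hfin : ∀ n, Metric.ediam (t n) ≠ ⊤ := fun n =>
    ne_top_of_le_ne_top ENNReal.ofReal_ne_top (htd n)
  have hdiam : ∀ n, Metric.diam (t n) ≤ 1 / 2 := fun n =>
    ENNReal.toReal_le_of_le_ofReal (by norm_num) (htd n)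
  choose m hm1 hm2 using fun n => exists_half_pow_near (Metric.diam_nonneg (s := t n)) (hdiam n)
    (by positivity : 0 < η / 8 * (1 / 2) ^ n) hs hs'
  have ha : ∀ n, ∃ a : ℝ, ∀ x ∈ t n, |x - a| < (1 / 2) ^ m n := by
    intro n
    rcases (t n).eq_empty_or_nonempty with he | ⟨a, ha⟩
    · exact ⟨0, by simp [he]⟩
    · exact ⟨a, fun x hx => (Metric.dist_le_diam_of_mem' (hfin n) hx ha).trans_lt (hm1 n)⟩
  choose a ha using ha
  obtain ⟨F, hF⟩ := hA.elim_finite_subcover (fun n => Metric.ball (a n) ((1 / 2) ^ m n))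
    (fun n => Metric.isOpen_ball)
    (htA.trans (Set.iUnion_mono fun n x hx => by
      simpa [Real.dist_eq] using ha n x hx))
  refine ⟨F, a, m, fun x hx => ?_, ?_⟩
  · obtain ⟨i, hi, hx⟩ := Set.mem_iUnion₂.1 (hF hx)
    exact ⟨i, hi, by simpa [Real.dist_eq] using hx⟩
  · have h1 : ∑ i ∈ F, Metric.diam (t i) ^ s ≤ η / 8 := by
      rw [← ENNReal.ofReal_le_ofReal_iff (by positivity), ENNReal.ofReal_sum_of_nonneg
        (fun i _ => Real.rpow_nonneg Metric.diam_nonneg s)]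
      refine le_trans (Finset.sum_le_sum fun i _ => ?_)
        ((ENNReal.sum_le_tsum F).trans hsum.le)
      rcases (t i).eq_empty_or_nonempty with he | hne
      · simp [he, Real.zero_rpow hs.ne']
      · rw [← ENNReal.ofReal_rpow_of_nonneg Metric.diam_nonneg hs.le, Metric.diam,
          ENNReal.ofReal_toReal (hfin i)]
        exact le_iSup (fun _ : (t i).Nonempty => Metric.ediam (t i) ^ s) hne
    have h2 : ∑ i ∈ F, (1 / 2 : ℝ) ^ i ≤ 2 := by
      exact (summable_geometric_two.sum_le_tsum F fun i _ => by positivity).trans_eq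
        tsum_geometric_two
    calc ∑ i ∈ F, ((1 / 2 : ℝ) ^ m i) ^ s
        ≤ ∑ i ∈ F, (4 * Metric.diam (t i) ^ s + η / 8 * (1 / 2) ^ i) :=
          Finset.sum_le_sum fun i _ => hm2 i
      _ = 4 * ∑ i ∈ F, Metric.diam (t i) ^ s + η / 8 * ∑ i ∈ F, (1 / 2 : ℝ) ^ i := by
          rw [Finset.sum_add_distrib, Finset.mul_sum, Finset.mul_sum]
      _ < η := by nlinarith

lemma Irrational.exists_rat_near_den_ge {α : ℝ} (hα : Irrational α) (N : ℕ) :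
    ∃ r : ℚ, |α - r| < 1 / (r.den : ℝ) ^ 2 ∧ N ≤ r.den := by
  by_contra! H
  refine Real.infinite_rat_abs_sub_lt_one_div_den_sq_of_irrational hα ?_
  have hsub : {r : ℚ | |α - r| < 1 / (r.den : ℝ) ^ 2} ⊆
      (fun x : ℤ × ℕ => (x.1 : ℚ) / x.2) ''
        (Set.Icc (-(⌈(|α| + 1) * N⌉)) ⌈(|α| + 1) * N⌉ ×ˢ Set.Iic N) := by
    intro r hr
    have hden : (1 : ℝ) ≤ r.den := by exact_mod_cast r.den_pos
    have hlt := H r hr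
    have hlt' : (r.den : ℝ) ≤ N := by exact_mod_cast hlt.le
    refine ⟨(r.num, r.den), ⟨?_, hlt.le⟩, Rat.num_div_den r⟩
    have h1 : |(r : ℝ)| ≤ |α| + 1 := by
      have : |α - r| ≤ 1 := (le_of_lt hr).trans (by
        rw [div_le_one (by positivity)]
        exact one_le_pow₀ hden)
      have h2 := abs_sub_abs_le_abs_sub (r : ℝ) α
      rw [abs_sub_comm] at h2
      linarith
    have h2 : |(r.num : ℝ)| ≤ (|α| + 1) * N := by
      have : (r.num : ℝ) = r * r.den := by exact_mod_cast (Rat.mul_den_eq_num r).symm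
      rw [this, abs_mul, Nat.abs_cast]
      gcongr
    have h3 : |r.num| ≤ ⌈(|α| + 1) * N⌉ := by
      have := h2.trans (Int.le_ceil _)
      exact_mod_cast this
    exact abs_le.1 h3
  exact (((Set.finite_Icc _ _).prod (Set.finite_Iic N)).image _).subset hsub

/-- The block of `m` binary digits of `d` after position `n`, read as an integer. -/
noncomputable def digitBlock (d : ℝ) (n m : ℕ) : ℤ :=
  ⌊2 ^ (n + m) * d⌋ - 2 ^ m * ⌊2 ^ n * d⌋

lemma digitBlock_add (d : ℝ) (n m k : ℕ) :
    digitBlock d n (m + k) = 2 ^ k * digitBlock d n m + digitBlock d (n + m) k := by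
  simp only [digitBlock, add_assoc]
  ring

lemma digitBlock_le_mul_fract (d : ℝ) (n m : ℕ) :
    (digitBlock d n m : ℝ) ≤ 2 ^ m * Int.fract (2 ^ n * d) := by
  have := Int.floor_le ((2 : ℝ) ^ (n + m) * d)
  rw [Int.fract, digitBlock]
  push_cast
  rw [pow_add] at *
  linarith

lemma mul_fract_lt_digitBlock_add_one (d : ℝ) (n m : ℕ) :
    2 ^ m * Int.fract (2 ^ n * d) < (digitBlock d n m : ℝ) + 1 := by
  have := Int.lt_floor_add_one ((2 : ℝ) ^ (n + m) * d)
  rw [Int.fract, digitBlock]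
  push_cast
  rw [pow_add] at *
  linarith

lemma digitBlock_mem_Ico (d : ℝ) (n m : ℕ) : digitBlock d n m ∈ Finset.Ico 0 (2 ^ m) := by
  have h2 : (0 : ℝ) < 2 ^ m := by positivity
  rw [Finset.mem_Ico]
  constructor
  · have h := mul_fract_lt_digitBlock_add_one d n m
    have : (-1 : ℝ) < digitBlock d n m := by
      nlinarith [Int.fract_nonneg ((2 : ℝ) ^ n * d)]
    have : (-1 : ℤ) < digitBlock d n m := by exact_mod_cast this
    omega
  · have h := digitBlock_le_mul_fract d n m
    have : (digitBlock d n m : ℝ) < 2 ^ m := by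
      nlinarith [Int.fract_lt_one ((2 : ℝ) ^ n * d)]
    exact_mod_cast this

/-- The `m`-digit blocks occurring in the binary expansion of `d` after positions in `T`. -/
def digitBlocks (d : ℝ) (T : Set ℕ) (m : ℕ) : Set ℤ := (fun n => digitBlock d n m) '' T

lemma digitBlocks_subset_Ico (d : ℝ) (T : Set ℕ) (m : ℕ) :
    digitBlocks d T m ⊆ (Finset.Ico 0 (2 ^ m) : Finset ℤ) := by
  rintro _ ⟨n, -, rfl⟩
  exact digitBlock_mem_Ico d n m

lemma finite_digitBlocks (d : ℝ) (T : Set ℕ) (m : ℕ) : (digitBlocks d T m).Finite :=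
  (Finset.finite_toSet _).subset (digitBlocks_subset_Ico d T m)

lemma ncard_digitBlocks_le (d : ℝ) (T : Set ℕ) (m : ℕ) : (digitBlocks d T m).ncard ≤ 2 ^ m := by
  refine (Set.ncard_le_ncard (digitBlocks_subset_Ico d T m) (Finset.finite_toSet _)).trans ?_
  rw [Set.ncard_coe_finset, Int.card_Ico, sub_zero]
  simp

lemma ncard_digitBlocks_add_le (d : ℝ) (T T' : Set ℕ) (m k : ℕ) (hT : ∀ n ∈ T, n + m ∈ T') :
    (digitBlocks d T (m + k)).ncard ≤ (digitBlocks d T m).ncard * (digitBlocks d T' k).ncard := by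
  rw [← Set.ncard_prod]
  have hfin := (finite_digitBlocks d T m).prod (finite_digitBlocks d T' k)
  refine le_trans (Set.ncard_le_ncard ?_ (hfin.image fun x : ℤ × ℤ => 2 ^ k * x.1 + x.2))
    (Set.ncard_image_le hfin)
  rintro _ ⟨n, hn, rfl⟩
  exact ⟨(digitBlock d n m, digitBlock d (n + m) k), ⟨⟨n, hn, rfl⟩, ⟨n + m, hT n hn, rfl⟩⟩,
    (digitBlock_add d n m k).symm⟩

/-- The exponential growth rate of the number of digit blocks. -/
lemma exists_growth_rate_digitBlocks (d : ℝ) : ∃ h : ℝ, 0 ≤ h ∧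
    (∀ m : ℕ, Real.exp (h * m) ≤ (digitBlocks d (Set.Ici 1) m).ncard) ∧
    ∀ ε > 0, ∃ M : ℕ, ∀ m ≥ M, ((digitBlocks d (Set.Ici 1) m).ncard : ℝ) ≤
      Real.exp ((h + ε) * m) := by
  set p : ℕ → ℕ := fun m => (digitBlocks d (Set.Ici 1) m).ncard with hp
  have hpos : ∀ m, 0 < p m := fun m =>
    (Set.ncard_pos (finite_digitBlocks d _ m)).2 ⟨_, 1, by simp, rfl⟩
  have hpos' : ∀ m, (0 : ℝ) < p m := fun m => by exact_mod_cast hpos m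
  have hone : ∀ m, (1 : ℝ) ≤ p m := fun m => by exact_mod_cast hpos m
  have hsub : Subadditive fun m => Real.log (p m) := by
    intro m k
    rw [← Real.log_mul (hpos' m).ne' (hpos' k).ne']
    apply Real.log_le_log (hpos' _)
    exact_mod_cast ncard_digitBlocks_add_le d (Set.Ici 1) (Set.Ici 1) m k
      (fun n hn => by simp only [Set.mem_Ici] at *; omega)
  have hnn : ∀ m : ℕ, 0 ≤ Real.log (p m) / m := fun m =>
    div_nonneg (Real.log_nonneg (hone m)) (Nat.cast_nonneg m)
  have hbdd : BddBelow (Set.range fun m : ℕ => Real.log (p m) / m) :=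
    ⟨0, by rintro _ ⟨m, rfl⟩; exact hnn m⟩
  have hlim := hsub.tendsto_lim hbdd
  refine ⟨hsub.lim, ge_of_tendsto' hlim hnn, fun m => ?_, fun ε hε => ?_⟩
  · rcases Nat.eq_zero_or_pos m with rfl | hm
    · simpa using hone 0
    · have := hsub.lim_le_div hbdd hm.ne'
      rw [le_div_iff₀ (by exact_mod_cast hm)] at this
      exact (Real.le_log_iff_exp_le (hpos' m)).1 this
  · obtain ⟨M, hM⟩ := Filter.eventually_atTop.1
      (hlim.eventually_lt_const (lt_add_of_pos_right hsub.lim hε))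
    refine ⟨M + 1, fun m hm => ?_⟩
    have := hM m (by omega)
    rw [div_lt_iff₀ (by exact_mod_cast (by omega : 0 < m))] at this
    exact (Real.log_le_iff_le_exp (hpos' m)).1 this.le

/-- If at every time outside `B` the blocks can be parsed using a list of total `θ`-weight at most
one, then the number of long blocks is controlled by `θ` and the number of visits to `B`. -/
lemma ncard_digitBlocks_mul_pow_le (d : ℝ) {ι : Type*} (m : ι → ℕ) (w : ι → ℤ)
    (T : Set ℕ) (B : ℕ → Prop)
    [DecidablePred B] (L : ℕ → Finset ι) {θ : ℝ} (hθ : 0 < θ) (hθ' : θ ≤ 2) {M q : ℕ}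
    (hm : ∀ k, ∀ x ∈ L k, 1 ≤ m x ∧ m x ≤ M)
    (hL : ∀ k, ¬ B k → ∑ x ∈ L k, θ ^ m x ≤ 1)
    (hcover : ∀ k < q, ∀ n ∈ T, ∃ x ∈ L k, digitBlock d (n + k) (m x) = w x)
    (l : ℕ) (k : ℕ) (hk : k + l ≤ q) :
    ((digitBlocks d ((· + k) '' T) l).ncard : ℝ) * θ ^ l ≤
      4 ^ M * 4 ^ ((Finset.Ico k (k + l)).filter B).card := by
  induction l using Nat.strong_induction_on generalizing k with
  | _ l ih =>
  rcases le_or_gt l M with hlM | hlM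
  · calc ((digitBlocks d ((· + k) '' T) l).ncard : ℝ) * θ ^ l ≤ 2 ^ l * 2 ^ l := by
          gcongr
          exact_mod_cast ncard_digitBlocks_le d _ l
      _ = 4 ^ l := by rw [← mul_pow]; norm_num
      _ ≤ 4 ^ M := pow_le_pow_right₀ (by norm_num) hlM
      _ ≤ _ := le_mul_of_one_le_right (by positivity) (one_le_pow₀ (by norm_num))
  obtain ⟨l, rfl⟩ : ∃ l', l = l' + 1 := ⟨l - 1, by omega⟩
  by_cases hB : B k
  · have h1 := ncard_digitBlocks_add_le d ((· + k) '' T) ((· + (k + 1)) '' T) 1 l (by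
      rintro _ ⟨n, hn, rfl⟩
      exact ⟨n, hn, by simp only; omega⟩)
    have h2 := ncard_digitBlocks_le d ((· + k) '' T) 1
    have h3 := ih l (by omega) (k + 1) (by omega)
    have h4 : ((Finset.Ico k (k + (l + 1))).filter B).card =
        ((Finset.Ico (k + 1) (k + 1 + l)).filter B).card + 1 := by
      rw [← Finset.insert_Ico_add_one_left_eq_Ico (by omega : k < k + (l + 1)),
        Finset.filter_insert, if_pos hB, Finset.card_insert_of_notMem (by simp),
        show k + (l + 1) = k + 1 + l by omega]
    have h5 : ((digitBlocks d ((· + k) '' T) (l + 1)).ncard : ℝ) ≤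
        2 * (digitBlocks d ((· + (k + 1)) '' T) l).ncard := by
      rw [add_comm l 1]
      exact_mod_cast h1.trans (Nat.mul_le_mul_right _ h2)
    rw [h4, pow_succ, pow_succ]
    calc _ ≤ (2 * (digitBlocks d ((· + (k + 1)) '' T) l).ncard : ℝ) * (θ ^ l * θ) := by gcongr
      _ = ((digitBlocks d ((· + (k + 1)) '' T) l).ncard * θ ^ l : ℝ) * (2 * θ) := by ring
      _ ≤ (4 ^ M * 4 ^ ((Finset.Ico (k + 1) (k + 1 + l)).filter B).card) * 4 := by
          gcongr
          linarith
      _ = _ := by ring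
  · set N := 4 ^ M * (4 : ℝ) ^ ((Finset.Ico k (k + (l + 1))).filter B).card with hN
    set S : ι → Set ℤ := fun x =>
      (fun v => 2 ^ (l + 1 - m x) * w x + v) ''
        digitBlocks d ((· + (k + m x)) '' T) (l + 1 - m x) with hS
    have hSfin : ∀ x, (S x).Finite := fun x => (finite_digitBlocks _ _ _).image _
    have hsub : digitBlocks d ((· + k) '' T) (l + 1) ⊆ ⋃ x ∈ L k, S x := by
      rintro _ ⟨_, ⟨n, hn, rfl⟩, rfl⟩
      obtain ⟨x, hx, hxw⟩ := hcover k (by omega) n hn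
      have hmx := hm k x hx
      refine Set.mem_iUnion₂.2 ⟨x, hx, _, ⟨_, ⟨n, hn, rfl⟩, rfl⟩, ?_⟩
      have := digitBlock_add d (n + k) (m x) (l + 1 - m x)
      rw [Nat.add_sub_cancel' (by omega), hxw] at this
      simp only [this, add_assoc]
    have hcard : ((digitBlocks d ((· + k) '' T) (l + 1)).ncard : ℝ) ≤
        ∑ x ∈ L k, ((digitBlocks d ((· + (k + m x)) '' T) (l + 1 - m x)).ncard : ℝ) := by
      have h1 := Set.ncard_le_ncard hsub ((L k).finite_toSet.biUnion fun x _ => hSfin x)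
      have h2 := h1.trans (Finset.set_ncard_biUnion_le (L k) S)
      have h3 := h2.trans (Finset.sum_le_sum fun x _ =>
        Set.ncard_image_le (finite_digitBlocks d ((· + (k + m x)) '' T) (l + 1 - m x)))
      exact_mod_cast h3
    calc _ ≤ (∑ x ∈ L k, ((digitBlocks d ((· + (k + m x)) '' T)
              (l + 1 - m x)).ncard : ℝ)) * θ ^ (l + 1) := by gcongr
      _ ≤ ∑ x ∈ L k, N * θ ^ m x := by
          rw [Finset.sum_mul]
          refine Finset.sum_le_sum fun x hx => ?_
          have hmx := hm k x hx
          have h1 := ih (l + 1 - m x) (by omega) (k + m x) (by omega)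
          have h2 : ((Finset.Ico (k + m x) (k + m x + (l + 1 - m x))).filter B).card ≤
              ((Finset.Ico k (k + (l + 1))).filter B).card := by
            refine Finset.card_le_card (Finset.filter_subset_filter _ ?_)
            exact Finset.Ico_subset_Ico (by omega) (by omega)
          have h3 : θ ^ (l + 1) = θ ^ (l + 1 - m x) * θ ^ m x := by
            rw [← pow_add, Nat.sub_add_cancel (by omega)]
          rw [h3, ← mul_assoc]
          gcongr
          refine h1.trans ?_
          rw [hN]
          gcongr
          norm_num
      _ = N * ∑ x ∈ L k, θ ^ m x := by rw [Finset.mul_sum]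
      _ ≤ N * 1 := by
          gcongr
          exact hL k hB
      _ = N := mul_one N

/-- A residue `r` modulo `q` is `R`-near to `a` if some representative `ρ` of `r` satisfies
`|ρ / q - a| ≤ R`. -/
def ResidueNear (q : ℕ) (a R : ℝ) (r : ZMod q) : Prop :=
  ∃ ρ : ℤ, (ρ : ZMod q) = r ∧ |(ρ : ℝ) / q - a| ≤ R

open Classical in
lemma card_residueNear_le (q : ℕ) [NeZero q] (a : ℝ) {R : ℝ} (hR : 0 ≤ R) :
    ((Finset.univ.filter (ResidueNear q a R)).card : ℝ) ≤ 2 * R * q + 1 := by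
  have hq : (0 : ℝ) < q := by exact_mod_cast NeZero.pos q
  have hsub : Finset.univ.filter (ResidueNear q a R) ⊆
      (Finset.Icc ⌈(a - R) * q⌉ ⌊(a + R) * q⌋).image fun ρ : ℤ => (ρ : ZMod q) := by
    intro r hr
    obtain ⟨ρ, rfl, hρ⟩ := (Finset.mem_filter.1 hr).2
    refine Finset.mem_image_of_mem _ (Finset.mem_Icc.2 ⟨Int.ceil_le.2 ?_, Int.le_floor.2 ?_⟩)
    · rw [← le_div_iff₀ hq]
      linarith [(abs_le.1 hρ).1]
    · rw [← div_le_iff₀ hq]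
      linarith [(abs_le.1 hρ).2]
  have h1 := (Finset.card_le_card hsub).trans Finset.card_image_le
  rw [Int.card_Icc] at h1
  have h2 : (((⌊(a + R) * q⌋ + 1 - ⌈(a - R) * q⌉).toNat : ℤ) : ℝ) ≤ 2 * R * q + 1 := by
    rw [Int.toNat_eq_max]
    push_cast
    refine max_le ?_ (by positivity)
    linarith [Int.floor_le ((a + R) * q), Int.le_ceil ((a - R) * q)]
  refine le_trans ?_ h2
  exact_mod_cast h1

lemma residueNear_of_abs_fract_sub_lt {α d a : ℝ} {p : ℤ} {q : ℕ} (hq : 0 < q)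
    (hα : |α - p / q| ≤ 1 / (q : ℝ) ^ 2) {n k m : ℕ} (hk : k ≤ q) (hm : 2 ^ m ≤ q)
    (ha : |Int.fract (((n + k : ℕ) : ℝ) * α + 2 ^ (n + k) * d) - a| < (1 / 2) ^ m) :
    ResidueNear q (a - digitBlock d (n + k) m / 2 ^ m) (4 * (1 / 2) ^ m)
      ((⌊q * (n * α)⌋ : ℤ) + k * p : ZMod q) := by
  have hq' : (0 : ℝ) < q := by exact_mod_cast hq
  set x := ((n + k : ℕ) : ℝ) * α + 2 ^ (n + k) * d with hx
  refine ⟨⌊q * (n * α)⌋ + k * p - q * (⌊x⌋ - ⌊2 ^ (n + k) * d⌋), by simp, ?_⟩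
  have hhalf : (1 / 2 : ℝ) ^ m = 1 / 2 ^ m := by rw [div_pow, one_pow]
  have h2m : (0 : ℝ) < 2 ^ m := by positivity
  have hfr1 : (digitBlock d (n + k) m : ℝ) / 2 ^ m ≤ Int.fract (2 ^ (n + k) * d) := by
    rw [div_le_iff₀ h2m, mul_comm]
    exact digitBlock_le_mul_fract d (n + k) m
  have hfr2 : Int.fract (2 ^ (n + k) * d) ≤
      (digitBlock d (n + k) m : ℝ) / 2 ^ m + (1 / 2) ^ m := by
    rw [hhalf, ← add_div, le_div_iff₀ h2m, mul_comm]
    exact (mul_fract_lt_digitBlock_add_one d (n + k) m).le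
  have hqm : 1 / (q : ℝ) ≤ (1 / 2) ^ m := by
    rw [hhalf]
    exact one_div_le_one_div_of_le h2m (by exact_mod_cast hm)
  have hn1 : (⌊q * (n * α)⌋ : ℝ) / q ≤ n * α := by
    rw [div_le_iff₀ hq', mul_comm]
    exact Int.floor_le _
  have hn2 : n * α ≤ (⌊q * (n * α)⌋ : ℝ) / q + 1 / q := by
    rw [← add_div, le_div_iff₀ hq', mul_comm]
    exact (Int.lt_floor_add_one _).le
  have hkα : |k * α - k * (p / q)| ≤ 1 / q := by
    rw [← mul_sub, abs_mul, Nat.abs_cast]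
    calc (k : ℝ) * |α - p / q| ≤ q * (1 / (q : ℝ) ^ 2) := by gcongr
      _ = 1 / q := by field_simp
  have hxe : x = n * α + k * α + 2 ^ (n + k) * d := by
    rw [hx]
    push_cast
    ring
  have hρ : (((⌊q * (n * α)⌋ + k * p - q * (⌊x⌋ - ⌊2 ^ (n + k) * d⌋) : ℤ) : ℝ)) / q =
      (⌊q * (n * α)⌋ : ℝ) / q + k * (p / q) - (⌊x⌋ - ⌊2 ^ (n + k) * d⌋) := by
    push_cast
    field_simp
  rw [hρ]
  rw [Int.fract] at ha hfr1 hfr2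
  rw [abs_lt] at ha
  rw [abs_le] at hkα ⊢
  constructor <;> linarith [ha.1, ha.2, hkα.1, hkα.2]

open Classical in
lemma card_bad_le {q : ℕ} [NeZero q] {X : Type*} (S : Finset X) (f : X → ℝ) (hf : ∀ x, 0 ≤ f x)
    (near : X → ZMod q → Prop) :
    ((Finset.univ.filter fun r => 1 < ∑ x ∈ S.filter (near · r), f x).card : ℝ) ≤
      ∑ x ∈ S, f x * (Finset.univ.filter (near x)).card := by
  calc ((Finset.univ.filter fun r => 1 < ∑ x ∈ S.filter (near · r), f x).card : ℝ)
      = ∑ r ∈ Finset.univ.filter fun r => 1 < ∑ x ∈ S.filter (near · r), f x, (1 : ℝ) := by simp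
    _ ≤ ∑ r ∈ Finset.univ.filter fun r => 1 < ∑ x ∈ S.filter (near · r), f x,
          ∑ x ∈ S.filter (near · r), f x :=
        Finset.sum_le_sum fun r hr => (Finset.mem_filter.1 hr).2.le
    _ ≤ ∑ r, ∑ x ∈ S.filter (near · r), f x :=
        Finset.sum_le_sum_of_subset_of_nonneg (Finset.filter_subset _ _)
          fun r _ _ => Finset.sum_nonneg fun x _ => hf x
    _ = ∑ x ∈ S, f x * (Finset.univ.filter (near x)).card := by
        simp only [Finset.sum_filter]
        rw [Finset.sum_comm]
        refine Finset.sum_congr rfl fun x _ => ?_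
        rw [← Finset.sum_filter, Finset.sum_const, nsmul_eq_mul, mul_comm]

lemma ncard_digitBlocks_mul_pow_le_of_cover {α d θ b : ℝ} {p : ℤ} {q M : ℕ} [NeZero q]
    (hpq : IsCoprime p (q : ℤ)) (hα : |α - p / q| ≤ 1 / (q : ℝ) ^ 2) (hMq : 2 ^ M ≤ q)
    (hθ : 0 < θ) (hθ' : θ ≤ 2) (F : Finset ℕ) (a : ℕ → ℝ) (m : ℕ → ℕ)
    (hm : ∀ i ∈ F, 1 ≤ m i ∧ m i ≤ M)
    (hcover : ∀ n : ℕ, 1 ≤ n → ∃ i ∈ F, |Int.fract (n * α + 2 ^ n * d) - a i| < (1 / 2) ^ m i)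
    (hb : 9 * q * ∑ i ∈ F, (digitBlocks d (Set.Ici 1) (m i)).ncard * (θ / 2) ^ m i ≤ b) :
    ((digitBlocks d (Set.Ici 1) q).ncard : ℝ) * θ ^ q ≤ q * (4 ^ M * (4 : ℝ) ^ b) := by
  classical
  have hq : 0 < q := NeZero.pos q
  set S : Finset (Σ _ : ℕ, ℤ) :=
    F.sigma fun i => (finite_digitBlocks d (Set.Ici 1) (m i)).toFinset with hS
  set near : (Σ _ : ℕ, ℤ) → ZMod q → Prop := fun x =>
    ResidueNear q (a x.1 - x.2 / 2 ^ m x.1) (4 * (1 / 2) ^ m x.1) with hnear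
  set bad : ZMod q → Prop := fun r => 1 < ∑ x ∈ S.filter (near · r), θ ^ m x.1 with hbad
  have hbad_card : ((Finset.univ.filter bad).card : ℝ) ≤ b := by
    refine (card_bad_le S (fun x => θ ^ m x.1) (fun x => by positivity) near).trans
      (le_trans ?_ hb)
    rw [hS, Finset.sum_sigma, Finset.mul_sum]
    refine Finset.sum_le_sum fun i hi => ?_
    have hqm : (1 : ℝ) ≤ (1 / 2) ^ m i * q := by
      rw [div_pow, one_pow, div_mul_eq_mul_div, one_mul, one_le_div (by positivity)]
      exact_mod_cast (Nat.pow_le_pow_right (by norm_num) (hm i hi).2).trans hMq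
    calc _ ≤ ∑ w ∈ (finite_digitBlocks d (Set.Ici 1) (m i)).toFinset,
              θ ^ m i * (9 * ((1 / 2) ^ m i * q)) := by
          refine Finset.sum_le_sum fun w _ => ?_
          refine mul_le_mul_of_nonneg_left ?_ (by positivity)
          refine (card_residueNear_le q _ (by positivity)).trans ?_
          linarith
      _ = _ := by
          rw [Finset.sum_const, nsmul_eq_mul,
            ← Set.ncard_eq_toFinset_card _ (finite_digitBlocks d (Set.Ici 1) (m i)), div_pow,
            div_pow, one_pow]
          ring
  set T : ZMod q → Set ℕ := fun j => {n | 1 ≤ n ∧ ((⌊q * (n * α)⌋ : ℤ) : ZMod q) = j} with hT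
  have hphase : ∀ j, ((digitBlocks d (T j) q).ncard : ℝ) * θ ^ q ≤ 4 ^ M * (4 : ℝ) ^ b := by
    intro j
    have h1 := ncard_digitBlocks_mul_pow_le d (fun x : Σ _ : ℕ, ℤ => m x.1) (fun x => x.2) (T j)
      (fun k => bad (j + k * p)) (fun k => S.filter (near · (j + k * p))) hθ hθ' (M := M) (q := q)
      (fun k x hx => hm x.1 (Finset.mem_sigma.1 (Finset.mem_filter.1 hx).1).1)
      (fun k hk => not_lt.1 hk) ?_ q 0 (by omega)
    · have hinj : ((Finset.Ico 0 (0 + q)).filter fun k : ℕ => bad (j + k * p)).card ≤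
          (Finset.univ.filter bad).card := by
        refine Finset.card_le_card_of_injOn (fun k : ℕ => j + k * p)
          (fun k hk => by simpa using (Finset.mem_filter.1 hk).2) ?_
        intro k hk k' hk' hkk
        have hk1 := Finset.mem_Ico.1 (Finset.mem_filter.1 hk).1
        have hk1' := Finset.mem_Ico.1 (Finset.mem_filter.1 hk').1
        have hunit : IsUnit (p : ZMod q) := by
          obtain ⟨u, v, huv⟩ := hpq
          refine IsUnit.of_mul_eq_one (u : ZMod q) ?_
          have := congrArg (fun z : ℤ => (z : ZMod q)) huv
          simpa [mul_comm] using this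
        have h2 : (k : ZMod q) = k' := hunit.mul_right_cancel (add_left_cancel hkk)
        rw [ZMod.natCast_eq_natCast_iff] at h2
        exact Nat.ModEq.eq_of_lt_of_lt h2 (by omega) (by omega)
      have h3 : (4 : ℝ) ^ ((Finset.Ico 0 (0 + q)).filter fun k : ℕ => bad (j + k * p)).card ≤
          (4 : ℝ) ^ b := by
        rw [← Real.rpow_natCast]
        refine Real.rpow_le_rpow_of_exponent_le (by norm_num) (le_trans ?_ hbad_card)
        exact_mod_cast hinj
      simp only [add_zero, Set.image_id'] at h1
      refine h1.trans ?_
      gcongr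
    · rintro k hk n ⟨hn, rfl⟩
      obtain ⟨i, hi, hia⟩ := hcover (n + k) (by omega)
      refine ⟨⟨i, digitBlock d (n + k) (m i)⟩, Finset.mem_filter.2 ⟨Finset.mem_sigma.2
        ⟨hi, ?_⟩, ?_⟩, rfl⟩
      · rw [Set.Finite.mem_toFinset]
        exact ⟨n + k, by simp only [Set.mem_Ici]; omega, rfl⟩
      · exact residueNear_of_abs_fract_sub_lt hq hα hk.le
          ((Nat.pow_le_pow_right (by norm_num) (hm i hi).2).trans hMq) hia
  have hsub : digitBlocks d (Set.Ici 1) q ⊆ ⋃ j ∈ (Finset.univ : Finset (ZMod q)),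
      digitBlocks d (T j) q := by
    rintro _ ⟨n, hn, rfl⟩
    exact Set.mem_iUnion₂.2 ⟨_, Finset.mem_univ _, n, ⟨hn, rfl⟩, rfl⟩
  have hcard : ((digitBlocks d (Set.Ici 1) q).ncard : ℝ) ≤
      ∑ j : ZMod q, ((digitBlocks d (T j) q).ncard : ℝ) := by
    exact_mod_cast (Set.ncard_le_ncard hsub (Finset.univ.finite_toSet.biUnion
      fun j _ => finite_digitBlocks _ _ _)).trans (Finset.set_ncard_biUnion_le _ _)
  calc _ ≤ (∑ j : ZMod q, ((digitBlocks d (T j) q).ncard : ℝ)) * θ ^ q := by gcongr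
    _ ≤ ∑ j : ZMod q, 4 ^ M * (4 : ℝ) ^ b := by
        rw [Finset.sum_mul]
        exact Finset.sum_le_sum fun j _ => hphase j
    _ = q * (4 ^ M * (4 : ℝ) ^ b) := by
        rw [Finset.sum_const, nsmul_eq_mul, Finset.card_univ, ZMod.card]

lemma exists_le_sum_of_cover {α : ℝ} (d : ℝ) (hα : Irrational α) {s : ℝ} (hs : 0 < s)
    (hs' : s < 1) : ∃ η > 0, ∀ (F : Finset ℕ) (a : ℕ → ℝ) (m : ℕ → ℕ),
      (∀ n : ℕ, 1 ≤ n → ∃ i ∈ F, |Int.fract (n * α + 2 ^ n * d) - a i| < (1 / 2) ^ m i) →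
        η ≤ ∑ i ∈ F, ((1 / 2 : ℝ) ^ m i) ^ s := by
  obtain ⟨h, h0, hlow, hupp⟩ := exists_growth_rate_digitBlocks d
  have hlog2 : 0 < Real.log 2 := Real.log_pos (by norm_num)
  have hlog4 : 0 < Real.log 4 := Real.log_pos (by norm_num)
  set ε := (1 - s) / 2 * Real.log 2 with hε
  have hε0 : 0 < ε := mul_pos (by linarith) hlog2
  obtain ⟨M₀, hM₀⟩ := hupp ε hε0
  set η := min (ε / (18 * Real.log 4)) (((1 / 2 : ℝ) ^ M₀) ^ s) with hη
  have hη0 : 0 < η := lt_min (by positivity) (by positivity)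
  refine ⟨η, hη0, fun F a m hcover => ?_⟩
  by_contra! hsum
  have hmi : ∀ i ∈ F, M₀ < m i := by
    intro i hi
    have h1 : ((1 / 2 : ℝ) ^ m i) ^ s < ((1 / 2 : ℝ) ^ M₀) ^ s :=
      ((Finset.single_le_sum (f := fun i => ((1 / 2 : ℝ) ^ m i) ^ s)
        (fun i _ => by positivity) hi).trans_lt hsum).trans_le (min_le_right _ _)
    have h2 := (Real.rpow_lt_rpow_iff (by positivity) (by positivity) hs).1 h1
    exact (pow_lt_pow_iff_right_of_lt_one₀ (by norm_num) (by norm_num)).1 h2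
  set M := F.sup m with hM
  set θ := Real.exp (ε - h) with hθ
  have hεlog : ε ≤ Real.log 2 := by
    rw [hε]
    nlinarith
  have hθ2 : θ ≤ 2 := by
    rw [hθ, ← Real.exp_log (show (0 : ℝ) < 2 by norm_num)]
    exact Real.exp_le_exp.2 (by linarith)
  have htend := (tendsto_pow_const_mul_const_pow_of_abs_lt_one 1 (r := Real.exp (-(ε / 2)))
    (by rw [abs_of_pos (Real.exp_pos _), Real.exp_lt_one_iff]; linarith)).eventually_lt_const
    (show (0 : ℝ) < 1 / 4 ^ M by positivity)
  obtain ⟨N, hN⟩ := Filter.eventually_atTop.1 htend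
  obtain ⟨r, hr, hrN⟩ := hα.exists_rat_near_den_ge (max N (2 ^ M))
  set q := r.den with hq
  have hqpos : (0 : ℝ) < q := by exact_mod_cast r.den_pos
  have : NeZero q := ⟨r.den_nz⟩
  have hNq := hN q ((le_max_left _ _).trans hrN)
  rw [pow_one, lt_div_iff₀ (by positivity), ← Real.exp_nat_mul] at hNq
  have key := ncard_digitBlocks_mul_pow_le_of_cover (α := α) (d := d) (θ := θ) (b := 9 * q * η)
    (p := r.num) (q := q) (M := M)
    (Int.isCoprime_iff_gcd_eq_one.2 (by simpa [Int.gcd] using r.reduced))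
    (by rw [hq, ← Rat.cast_def]; exact hr.le) ((le_max_right _ _).trans hrN)
    (Real.exp_pos _) hθ2 F a m
    (fun i hi => ⟨by have := hmi i hi; omega, Finset.le_sup hi⟩) hcover ?_
  · have h4 : (4 : ℝ) ^ (9 * q * η) ≤ Real.exp (q * (ε / 2)) := by
      rw [Real.rpow_def_of_pos (by norm_num), Real.exp_le_exp]
      have : η * (18 * Real.log 4) ≤ ε := (le_div_iff₀ (by positivity)).1 (min_le_left _ _)
      nlinarith
    have h5 : Real.exp (q * ε) ≤ q * (4 ^ M * Real.exp (q * (ε / 2))) := by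
      calc Real.exp (q * ε) = Real.exp (h * q) * θ ^ q := by
            rw [hθ, ← Real.exp_nat_mul, ← Real.exp_add]
            ring_nf
        _ ≤ (digitBlocks d (Set.Ici 1) q).ncard * θ ^ q := by
            gcongr
            exact hlow q
        _ ≤ _ := key
        _ ≤ _ := by gcongr
    have h6 : Real.exp (q * ε) = Real.exp (q * (ε / 2)) * Real.exp (q * (ε / 2)) := by
      rw [← Real.exp_add]
      ring_nf
    rw [h6] at h5
    have h7 : Real.exp (q * (ε / 2)) * Real.exp (q * -(ε / 2)) = 1 := by
      rw [← Real.exp_add]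
      simp
    have h8 : Real.exp (q * (ε / 2)) ≤ q * 4 ^ M := by
      refine le_of_mul_le_mul_right ?_ (Real.exp_pos (q * (ε / 2)))
      linarith
    have h9 := mul_le_mul_of_nonneg_right h8 (Real.exp_pos (q * -(ε / 2))).le
    rw [h7] at h9
    linarith
  · refine mul_le_mul_of_nonneg_left (le_trans (Finset.sum_le_sum fun i hi => ?_) hsum.le)
      (by positivity)
    calc ((digitBlocks d (Set.Ici 1) (m i)).ncard : ℝ) * (θ / 2) ^ m i
        ≤ Real.exp ((h + ε) * m i) * (θ / 2) ^ m i := by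
          gcongr
          exact hM₀ _ (hmi i hi).le
      _ = ((1 / 2 : ℝ) ^ m i) ^ s := by
          have h2 : θ / 2 = Real.exp (ε - h - Real.log 2) := by
            rw [Real.exp_sub _ (Real.log 2), Real.exp_log (by norm_num)]
          have h3 : (1 / 2 : ℝ) = Real.exp (-Real.log 2) := by
            rw [Real.exp_neg, Real.exp_log (by norm_num), one_div]
          rw [h2, h3, ← Real.exp_nat_mul, ← Real.exp_nat_mul, ← Real.exp_mul, ← Real.exp_add, hε]
          ring_nf

/-- For an irrational real `α` and any real `d`, the closure of
`{frac (n α + 2^n d) : n ≥ 1}` has Hausdorff dimension `1`. -/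
theorem dimH_closure_fract_linear_plus_doubling (α d : ℝ) (hα : Irrational α) :
    dimH (closure {x : ℝ | ∃ n : ℕ, 1 ≤ n ∧ x = Int.fract ((n : ℝ) * α + 2 ^ n * d)}) = 1 := by
  set A := closure {x : ℝ | ∃ n : ℕ, 1 ≤ n ∧ x = Int.fract ((n : ℝ) * α + 2 ^ n * d)} with hA
  refine le_antisymm ((dimH_mono (Set.subset_univ A)).trans_eq Real.dimH_univ) ?_
  by_contra! hlt
  have hcomp : IsCompact A := by
    refine isCompact_Icc.of_isClosed_subset isClosed_closure
      (closure_minimal (t := Set.Icc (0 : ℝ) 1) ?_ isClosed_Icc)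
    rintro _ ⟨n, -, rfl⟩
    exact ⟨Int.fract_nonneg _, (Int.fract_lt_one _).le⟩
  obtain ⟨s, hs, hs'⟩ := ENNReal.lt_iff_exists_nnreal_btwn.1 hlt
  have hs0 : (0 : ℝ) < s := by
    have : (0 : ENNReal) < s := bot_le.trans_lt hs
    exact_mod_cast this
  have hs1 : (s : ℝ) < 1 := by exact_mod_cast hs'
  obtain ⟨η, hη, hle⟩ := exists_le_sum_of_cover d hα hs0 hs1
  obtain ⟨F, a, m, hcover, hsum⟩ := exists_finite_dyadic_cover hcomp hs0 hs1.le
    (hausdorffMeasure_of_dimH_lt hs) hη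
  exact (hle F a m fun n hn => hcover _ (subset_closure ⟨n, hn, rfl⟩)).not_gt hsum
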